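/- For every η ∈ (0,1) there exists c > 0 such that the following holds for all ε ∈ (0, 1/3], γ > 0, integers d ≥ 1, 1 ≤ s ≤ d, and n ≥ 1 with n ≤ c · (ε⁴/γ⁴) · s · log(e d / s). Let Θ := { θ ∈ {−1/√s, 0, 1/√s}^d : θ has exactly s nonzero coordinates } and for θ ∈ Θ let q_θ(x) := (1−ε)·φ_{γθ,I}(x) + ε·φ_{−((1−ε)/ε)γθ,I}(x). Then for every measurable function T : (ℝ^d)^n → {0,1}: ∫_{(ℝ^d)^n} T(x₁,…,x_n) ∏_{i=1}^n φ_{0,I}(x_i) dx + (1/|Θ|) ∑_{θ∈Θ} ∫_{(ℝ^d)^n} (1 − T(x₁,…,x_n)) ∏_{i=1}^n q_θ(x_i) dx ≥ 1 − 2η. -/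

import Mathlib

open MeasureTheory Real

/-- The Gaussian density `φ_{μ,I}` on `ℝ^d` with identity covariance. -/
noncomputable def gaussI {d : ℕ} (μ : Fin d → ℝ) (x : Fin d → ℝ) : ℝ :=
  (2 * π) ^ (-(d : ℝ) / 2) * Real.exp (-(1 / 2) * ∑ i, (x i - μ i) ^ 2)


lemma sign_avg {ι : Type*} [DecidableEq ι] (w : ι → ℝ) (A : Finset ι) :
    ∀ (x M : ℝ), 2 * ∑ i ∈ A, w i ^ 2 < M →
    ∑ B ∈ A.powerset, Real.exp ((x + ∑ i ∈ A, if i ∈ B then w i else -w i) ^ 2 / M) ≤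
      2 ^ A.card * Real.exp ((x ^ 2 + ∑ i ∈ A, w i ^ 2) / (M - 2 * ∑ i ∈ A, w i ^ 2)) := by
  induction A using Finset.induction_on with
  | empty => intro x M _; simp
  | insert a A ha ih =>
    intro x M hM
    rw [Finset.sum_insert ha] at hM
    rw [Finset.sum_powerset_insert ha, Finset.sum_insert ha, Finset.card_insert_of_notMem ha]
    set H := ∑ i ∈ A, w i ^ 2 with hH
    have hH0 : 0 ≤ H := Finset.sum_nonneg fun i _ => sq_nonneg _
    have hw0 := sq_nonneg (w a)
    have h1 := ih (x + -w a) M (by linarith)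
    have h2 := ih (x + w a) M (by linarith)
    have e1 : ∀ B ∈ A.powerset, Real.exp ((x + ∑ i ∈ insert a A, if i ∈ B then w i else -w i) ^ 2 / M)
        = Real.exp ((x + -w a + ∑ i ∈ A, if i ∈ B then w i else -w i) ^ 2 / M) := by
      intro B hB
      have : a ∉ B := fun h => ha (Finset.mem_powerset.1 hB h)
      rw [Finset.sum_insert ha, if_neg this, add_assoc]
    have e2 : ∀ B ∈ A.powerset,
        Real.exp ((x + ∑ i ∈ insert a A, if i ∈ insert a B then w i else -w i) ^ 2 / M)
        = Real.exp ((x + w a + ∑ i ∈ A, if i ∈ B then w i else -w i) ^ 2 / M) := by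
      intro B hB
      rw [Finset.sum_insert ha, if_pos (Finset.mem_insert_self _ _), add_assoc]
      have : ∀ i ∈ A, (if i ∈ insert a B then w i else -w i) = if i ∈ B then w i else -w i := by
        intro i hi
        have : i ≠ a := fun h => ha (h ▸ hi)
        simp [Finset.mem_insert, this]
      rw [Finset.sum_congr rfl this]
    rw [Finset.sum_congr rfl e1, Finset.sum_congr rfl e2]
    set K := M - 2 * H with hK
    have hK0 : 0 < K - 2 * w a ^ 2 := by linarith
    have hK1 : 0 < K := by linarith
    have e3 : M - 2 * (w a ^ 2 + H) = K - 2 * w a ^ 2 := by rw [hK]; ring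
    rw [e3]
    have key : Real.exp (((x + -w a) ^ 2 + H) / K) + Real.exp (((x + w a) ^ 2 + H) / K) ≤
        2 * Real.exp ((x ^ 2 + (w a ^ 2 + H)) / (K - 2 * w a ^ 2)) := by
      have a1 : Real.exp (((x + -w a) ^ 2 + H) / K) + Real.exp (((x + w a) ^ 2 + H) / K)
          = 2 * (Real.exp ((x ^ 2 + (w a ^ 2 + H)) / K) * Real.cosh (2 * x * w a / K)) := by
        rw [Real.cosh_eq]
        have : ∀ p q r : ℝ, 2 * (p * ((q + r) / 2)) = p * r + p * q := by intros; ring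
        rw [this, ← Real.exp_add, ← Real.exp_add]
        congr 2 <;> ring
      rw [a1]
      have a2 := Real.cosh_le_exp_half_sq (2 * x * w a / K)
      have a3 : (x ^ 2 + (w a ^ 2 + H)) / K + (2 * x * w a / K) ^ 2 / 2 ≤
          (x ^ 2 + (w a ^ 2 + H)) / (K - 2 * w a ^ 2) := by
        have b1 : (x ^ 2 + (w a ^ 2 + H)) / K + (2 * x * w a / K) ^ 2 / 2 =
          ((x ^ 2 + (w a ^ 2 + H)) * K + 2 * x ^ 2 * w a ^ 2) / K ^ 2 := by
          field_simp
        rw [b1, div_le_div_iff₀ (by positivity) hK0]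
        have : 0 ≤ w a ^ 2 * (w a ^ 2 + H) * K := by positivity
        have : 0 ≤ x ^ 2 * (w a ^ 2) ^ 2 := by positivity
        nlinarith
      calc _ ≤ 2 * (Real.exp ((x ^ 2 + (w a ^ 2 + H)) / K) * Real.exp ((2 * x * w a / K) ^ 2 / 2)) := by
            gcongr
        _ ≤ _ := by rw [← Real.exp_add]; gcongr
    calc _ ≤ 2 ^ A.card * Real.exp (((x + -w a) ^ 2 + H) / K) +
          2 ^ A.card * Real.exp (((x + w a) ^ 2 + H) / K) := add_le_add h1 h2
      _ ≤ 2 ^ A.card * (2 * Real.exp ((x ^ 2 + (w a ^ 2 + H)) / (K - 2 * w a ^ 2))) := by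
        rw [← mul_add]; gcongr
      _ = _ := by rw [pow_succ]; ring

lemma choose_bound (d s : ℕ) (hsd : s ≤ d) : ∀ j : ℕ, j ≤ s →
    (Nat.choose (d - j) (s - j)) * d ^ j ≤ Nat.choose d s * s ^ j := by
  intro j
  induction j with
  | zero => simp
  | succ j ih =>
    intro hj
    have h1 := ih (by omega)
    obtain ⟨b, rfl⟩ : ∃ b, s = b + 1 + j := ⟨s - (j + 1), by omega⟩
    obtain ⟨a, rfl⟩ : ∃ a, d = a + 1 + j := ⟨d - (j + 1), by omega⟩
    have e1 : a + 1 + j - (j + 1) = a := by omega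
    have e2 : b + 1 + j - (j + 1) = b := by omega
    have e3 : a + 1 + j - j = a + 1 := by omega
    have e4 : b + 1 + j - j = b + 1 := by omega
    rw [e1, e2]
    rw [e3, e4] at h1
    have h2 := Nat.add_one_mul_choose_eq a b
    have h3 : a.choose b * (a + 1 + j) ≤ (a + 1).choose (b + 1) * (b + 1 + j) := by
      have hab : b ≤ a := by omega
      have : a.choose b ≤ (a + 1).choose (b + 1) := by
        rw [Nat.choose_succ_succ]; omega
      nlinarith
    calc a.choose b * (a + 1 + j) ^ (j + 1) = (a.choose b * (a + 1 + j)) * (a + 1 + j) ^ j := by ring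
      _ ≤ ((a + 1).choose (b + 1) * (b + 1 + j)) * (a + 1 + j) ^ j := by gcongr
      _ = ((a + 1).choose (b + 1) * (a + 1 + j) ^ j) * (b + 1 + j) := by ring
      _ ≤ _ := by
        rw [pow_succ, ← mul_assoc]; gcongr

lemma card_superset (d s : ℕ) (A : Finset (Fin d)) :
    ((Finset.powersetCard s Finset.univ).filter (fun S => A ⊆ S)).card ≤
      Nat.choose (d - A.card) (s - A.card) := by
  have : (Finset.powersetCard (s - A.card) (Finset.univ \ A)).card
      = Nat.choose (d - A.card) (s - A.card) := by
    rw [Finset.card_powersetCard, Finset.card_sdiff_of_subset (Finset.subset_univ _)]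
    simp
  rw [← this]
  apply Finset.card_le_card_of_injOn (fun S => S \ A)
  · intro S hS
    simp only [Finset.coe_filter, Finset.mem_powersetCard, Set.mem_ofPred_eq] at hS
    simp only [Finset.mem_coe, Finset.mem_powersetCard]
    exact ⟨Finset.sdiff_subset_sdiff hS.1.1 le_rfl, by
      rw [Finset.card_sdiff_of_subset hS.2, hS.1.2]⟩
  · intro S hS S' hS' h
    simp only [Finset.coe_filter, Finset.mem_powersetCard, Set.mem_ofPred_eq] at hS hS'
    simp only at h
    rw [← Finset.sdiff_union_of_subset hS.2, h, Finset.sdiff_union_of_subset hS'.2]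

lemma hyper_mgf (d s : ℕ) (hd : 1 ≤ d) (hsd : s ≤ d) (S : Finset (Fin d)) (hS : S.card = s)
    (w : ℝ) (hw : 0 ≤ w) :
    ∑ S' ∈ Finset.powersetCard s (Finset.univ : Finset (Fin d)), (w + 1) ^ (S ∩ S').card ≤
      Nat.choose d s * (w * (s / d) + 1) ^ s := by
  have hd' : (0 : ℝ) < d := by exact_mod_cast hd
  have e : ∀ (T : Finset (Fin d)) (y : ℝ), (y + 1) ^ T.card = ∑ A ∈ T.powerset, y ^ A.card := by
    intro T y
    rw [← Finset.sum_pow_mul_eq_add_pow]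
    simp
  calc _ = ∑ S' ∈ Finset.powersetCard s (Finset.univ : Finset (Fin d)),
        ∑ A ∈ S.powerset, if A ⊆ S' then w ^ A.card else 0 := by
        refine Finset.sum_congr rfl fun S' _ => ?_
        rw [e, ← Finset.sum_filter]
        refine Finset.sum_congr ?_ fun _ _ => rfl
        ext A
        rw [Finset.mem_powerset, Finset.mem_filter, Finset.mem_powerset, Finset.subset_inter_iff]
    _ = ∑ A ∈ S.powerset, ((Finset.powersetCard s Finset.univ).filter (fun S' => A ⊆ S')).card
          * w ^ A.card := by
        rw [Finset.sum_comm]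
        refine Finset.sum_congr rfl fun A _ => ?_
        rw [← Finset.sum_filter, Finset.sum_const, nsmul_eq_mul]
    _ ≤ ∑ A ∈ S.powerset, Nat.choose d s * (w * (s / d)) ^ A.card := by
        refine Finset.sum_le_sum fun A hA => ?_
        have hA' : A.card ≤ s := hS ▸ Finset.card_le_card (Finset.mem_powerset.1 hA)
        have h1 : ((((Finset.powersetCard s Finset.univ).filter (fun S' => A ⊆ S')).card : ℕ) : ℝ)
            ≤ (Nat.choose (d - A.card) (s - A.card) : ℕ) := by
          exact_mod_cast card_superset d s A
        have h2 : ((Nat.choose (d - A.card) (s - A.card) : ℕ) : ℝ) * d ^ A.card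
            ≤ (Nat.choose d s : ℕ) * s ^ A.card := by
          exact_mod_cast choose_bound d s hsd A.card hA'
        rw [mul_pow, div_pow]
        have h3 : ((Nat.choose (d - A.card) (s - A.card) : ℕ) : ℝ) ≤
            (Nat.choose d s : ℕ) * (s ^ A.card / d ^ A.card) := by
          rw [← mul_div_assoc, le_div_iff₀ (by positivity)]; exact h2
        calc _ ≤ ((Nat.choose d s : ℕ) * ((s : ℝ) ^ A.card / d ^ A.card)) * w ^ A.card := by
              gcongr; exact h1.trans h3
          _ = _ := by ring
    _ = _ := by rw [← Finset.mul_sum, ← hS, e]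

def suppσ {d : ℕ} (σ : Fin d → Fin 3) : Finset (Fin d) := Finset.univ.filter (fun i => σ i ≠ 1)

def thetaSet (d s : ℕ) : Finset (Fin d → Fin 3) :=
  Finset.univ.filter (fun σ => (suppσ σ).card = s)

lemma sum_theta (d s : ℕ) (F : Finset (Fin d) → ℝ) :
    ∑ σ ∈ thetaSet d s, F (suppσ σ) = 2 ^ s * ∑ S ∈ Finset.powersetCard s Finset.univ, F S := by
  have hmaps : ∀ σ ∈ thetaSet d s, suppσ σ ∈ Finset.powersetCard s Finset.univ := by
    intro σ hσ
    simp only [thetaSet, Finset.mem_filter] at hσ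
    simp [Finset.mem_powersetCard, hσ.2]
  rw [← Finset.sum_fiberwise_of_maps_to hmaps, Finset.mul_sum]
  refine Finset.sum_congr rfl fun S hS => ?_
  have hS' := (Finset.mem_powersetCard.1 hS).2
  rw [Finset.sum_congr rfl (g := fun _ => F S)
    (fun σ hσ => by rw [(Finset.mem_filter.1 hσ).2]), Finset.sum_const, nsmul_eq_mul]
  congr 1
  have : (thetaSet d s).filter (fun σ => suppσ σ = S) =
      Fintype.piFinset (fun i => if i ∈ S then ({0, 2} : Finset (Fin 3)) else {1}) := by
    ext σ
    simp only [thetaSet, Finset.mem_filter, Finset.mem_univ, true_and, Fintype.mem_piFinset]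
    have h3 : ∀ a : Fin 3, (a ≠ 1 ↔ a ∈ ({0, 2} : Finset (Fin 3))) := by decide
    constructor
    · rintro ⟨_, h⟩ i
      subst h
      by_cases hi : σ i = 1
      · simp [suppσ, hi]
      · have := (h3 _).1 hi
        simpa [suppσ, hi] using this
    · intro h
      have : suppσ σ = S := by
        ext i
        have hi := h i
        by_cases hiS : i ∈ S
        · rw [if_pos hiS] at hi
          simp [suppσ, hiS, (h3 _).2 hi]
        · rw [if_neg hiS] at hi
          simp only [Finset.mem_singleton] at hi
          simp [suppσ, hiS, hi]
      exact ⟨by rw [this, hS'], this⟩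
  rw [this, Fintype.card_piFinset]
  have : ∀ i, (if i ∈ S then ({0, 2} : Finset (Fin 3)) else {1}).card = if i ∈ S then 2 else 1 := by
    intro i; split_ifs <;> rfl
  simp only [this]
  rw [Finset.prod_ite]
  simp [hS']

lemma card_theta (d s : ℕ) : ((thetaSet d s).card : ℝ) = 2 ^ s * Nat.choose d s := by
  have := sum_theta d s (fun _ => 1)
  simpa using this

def vv (a : Fin 3) : ℝ := ((a : ℕ) : ℝ) - 1

lemma vv_rev (a : Fin 3) : vv a.rev = - vv a := by
  fin_cases a <;> simp [vv, Fin.rev] <;> norm_num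

lemma vv_sq (a : Fin 3) : vv a ^ 2 = if a ≠ 1 then 1 else 0 := by
  fin_cases a <;> simp [vv] <;> norm_num

def flipσ {d : ℕ} (B : Finset (Fin d)) (σ : Fin d → Fin 3) : Fin d → Fin 3 :=
  fun i => if i ∈ B then σ i else (σ i).rev

lemma flipσ_flipσ {d : ℕ} (B : Finset (Fin d)) (σ : Fin d → Fin 3) : flipσ B (flipσ B σ) = σ := by
  funext i
  by_cases h : i ∈ B <;> simp [flipσ, h]

lemma flipσ_mem {d s : ℕ} (B : Finset (Fin d)) (σ : Fin d → Fin 3) (h : σ ∈ thetaSet d s) :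
    flipσ B σ ∈ thetaSet d s := by
  have : suppσ (flipσ B σ) = suppσ σ := by
    have h3 : ∀ a : Fin 3, a.rev = 1 ↔ a = 1 := by decide
    ext i
    have h4 : flipσ B σ i = 1 ↔ σ i = 1 := by
      by_cases h : i ∈ B
      · simp [flipσ, h]
      · simp [flipσ, h, h3]
    simp [suppσ, h4]
  simpa [thetaSet, this] using h

lemma sum_flipσ {d s : ℕ} (G : (Fin d → Fin 3) → ℝ) :
    ∑ σ ∈ thetaSet d s, ∑ B ∈ (Finset.univ : Finset (Fin d)).powerset, G (flipσ B σ) =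
      2 ^ d * ∑ σ ∈ thetaSet d s, G σ := by
  rw [Finset.sum_comm]
  have : ∀ B ∈ (Finset.univ : Finset (Fin d)).powerset, ∑ σ ∈ thetaSet d s, G (flipσ B σ) =
      ∑ σ ∈ thetaSet d s, G σ := by
    intro B _
    exact Finset.sum_nbij' (flipσ B) (flipσ B) (fun σ h => flipσ_mem B σ h)
      (fun σ h => flipσ_mem B σ h) (fun σ _ => flipσ_flipσ B σ) (fun σ _ => flipσ_flipσ B σ)
      (fun _ _ => rfl)
  rw [Finset.sum_congr rfl this, Finset.sum_const, Finset.card_powerset]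
  simp

lemma theta_avg (d s : ℕ) (hs : 1 ≤ s) (hsd : s ≤ d) (σ : Fin d → Fin 3) (hσ : σ ∈ thetaSet d s) :
    ∑ σ' ∈ thetaSet d s, Real.exp (Real.log (Real.exp 1 * d / s) / 24 *
      ((∑ i, vv (σ i) * vv (σ' i)) ^ 2 / s)) ≤ 3 * (thetaSet d s).card := by
  have hs' : (0 : ℝ) < s := by exact_mod_cast hs
  have hd' : (0 : ℝ) < d := by exact_mod_cast hs.trans hsd
  have hsd' : (s : ℝ) ≤ d := by exact_mod_cast hsd
  set L := Real.log (Real.exp 1 * d / s) with hL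
  have hexpL : Real.exp L = Real.exp 1 * d / s := Real.exp_log (by positivity)
  have hL1 : 1 ≤ L := by
    rw [hL, Real.le_log_iff_exp_le (by positivity), mul_div_assoc]
    have : (1 : ℝ) ≤ d / s := by rw [one_le_div hs']; exact hsd'
    nlinarith [Real.exp_pos 1]
  have hL0 : 0 < L := by linarith
  have hSσ : (suppσ σ).card = s := by simpa [thetaSet] using hσ
  have hh : ∀ σ' : Fin d → Fin 3, ∑ i, (vv (σ i) * vv (σ' i)) ^ 2 =
      ((suppσ σ ∩ suppσ σ').card : ℝ) := by
    intro σ'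
    have : suppσ σ ∩ suppσ σ' = Finset.univ.filter (fun i => σ i ≠ 1 ∧ σ' i ≠ 1) := by
      ext i; simp [suppσ]
    rw [this, Finset.card_filter]
    push_cast
    refine Finset.sum_congr rfl fun i _ => ?_
    rw [mul_pow, vv_sq, vv_sq]
    by_cases h1 : σ i = 1 <;> by_cases h2 : σ' i = 1 <;> simp [h1, h2]
  -- per-support bound
  have hb : ∀ σ' : Fin d → Fin 3, ∑ B ∈ (Finset.univ : Finset (Fin d)).powerset,
      Real.exp (L / 24 * ((∑ i, vv (σ i) * vv (flipσ B σ' i)) ^ 2 / s)) ≤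
      2 ^ d * (2 + Real.exp (-3 * s) * (Real.exp (13 / 24 * L)) ^ (suppσ σ ∩ suppσ σ').card) := by
    intro σ'
    set h := (suppσ σ ∩ suppσ σ').card with hhdef
    have hhs : (h : ℝ) ≤ s := by
      rw [← hSσ]; exact_mod_cast Finset.card_le_card Finset.inter_subset_left
    by_cases hc : (h : ℝ) ≤ 6 * s / L
    · have hM : 0 < 24 * s / L := by positivity
      have h4 : 4 * (h : ℝ) ≤ 24 * s / L := by
        have : 24 * (s : ℝ) / L = 4 * (6 * s / L) := by ring
        rw [this]; linarith
      have hlt : 2 * ∑ i, (vv (σ i) * vv (σ' i)) ^ 2 < 24 * s / L := by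
        rw [hh]
        rcases (Nat.cast_nonneg (α := ℝ) h).eq_or_lt with h0 | h0
        · rw [← h0]; simpa using hM
        · linarith
      have h1 := sign_avg (fun i => vv (σ i) * vv (σ' i)) Finset.univ 0 (24 * s / L) hlt
      have e1 : ∀ B : Finset (Fin d),
          Real.exp (L / 24 * ((∑ i, vv (σ i) * vv (flipσ B σ' i)) ^ 2 / s)) =
          Real.exp ((0 + ∑ i, if i ∈ B then vv (σ i) * vv (σ' i) else -(vv (σ i) * vv (σ' i))) ^ 2
            / (24 * s / L)) := by
        intro B
        have : ∀ i, vv (σ i) * vv (flipσ B σ' i) =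
            if i ∈ B then vv (σ i) * vv (σ' i) else -(vv (σ i) * vv (σ' i)) := by
          intro i
          by_cases hi : i ∈ B <;> simp [flipσ, hi, vv_rev]
        simp only [this]
        congr 1
        rw [zero_add]
        field_simp
      simp only [e1]
      refine h1.trans ?_
      simp only [Finset.card_univ, Fintype.card_fin]
      gcongr
      rw [hh, ← hhdef]
      have : Real.exp ((0 ^ 2 + (h : ℝ)) / (24 * s / L - 2 * h)) ≤ 2 := by
        have h5 : (0 ^ 2 + (h : ℝ)) / (24 * s / L - 2 * h) ≤ 1 / 2 := by
          rw [hh] at hlt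
          rw [div_le_iff₀ (by linarith)]
          linarith
        have h6 : Real.exp (1 / 2) ≤ 2 := by
          have : Real.exp (1 / 2) ^ 2 = Real.exp 1 := by rw [← Real.exp_nat_mul]; norm_num
          have h7 := Real.exp_one_lt_d9
          nlinarith [Real.exp_pos (1 / 2)]
        exact (Real.exp_le_exp.2 h5).trans h6
      have : 0 ≤ Real.exp (-3 * s) * (Real.exp (13 / 24 * L)) ^ h := by positivity
      linarith
    · push Not at hc
      have : ∀ B ∈ (Finset.univ : Finset (Fin d)).powerset,
          Real.exp (L / 24 * ((∑ i, vv (σ i) * vv (flipσ B σ' i)) ^ 2 / s)) ≤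
          2 + Real.exp (-3 * s) * (Real.exp (13 / 24 * L)) ^ h := by
        intro B _
        have hk : |∑ i, vv (σ i) * vv (flipσ B σ' i)| ≤ h := by
          refine (Finset.abs_sum_le_sum_abs _ _).trans ?_
          rw [hhdef, ← hh]
          refine Finset.sum_le_sum fun i _ => ?_
          have h3 : ∀ a : Fin 3, |vv a| = vv a ^ 2 := by
            intro a; fin_cases a <;> simp [vv] <;> norm_num
          have h4 : |vv (flipσ B σ' i)| = |vv (σ' i)| := by
            by_cases hi : i ∈ B <;> simp [flipσ, hi, vv_rev]
          rw [abs_mul, h4, h3, h3, mul_pow]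
        have hk2 : (∑ i, vv (σ i) * vv (flipσ B σ' i)) ^ 2 / s ≤ h := by
          rw [div_le_iff₀ hs', ← sq_abs]
          have := abs_nonneg (∑ i, vv (σ i) * vv (flipσ B σ' i))
          nlinarith
        rw [← Real.exp_nat_mul, ← Real.exp_add]
        rw [div_lt_iff₀ hL0] at hc
        have : L / 24 * ((∑ i, vv (σ i) * vv (flipσ B σ' i)) ^ 2 / s) ≤
            -3 * s + h * (13 / 24 * L) := by
          have : L / 24 * ((∑ i, vv (σ i) * vv (flipσ B σ' i)) ^ 2 / s) ≤ L / 24 * h := by gcongr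
          linarith
        have := Real.exp_le_exp.2 this
        linarith
      have := Finset.sum_le_card_nsmul _ _ _ this
      rw [Finset.card_powerset, nsmul_eq_mul] at this
      simpa only [Finset.card_univ, Fintype.card_fin, Nat.cast_pow, Nat.cast_ofNat] using this
  have h2d : (0 : ℝ) < 2 ^ d := by positivity
  rw [← mul_le_mul_iff_right₀ h2d, ← sum_flipσ]
  refine (Finset.sum_le_sum fun σ' _ => hb σ').trans ?_
  rw [← Finset.mul_sum]
  gcongr
  rw [sum_theta d s (fun S => 2 + Real.exp (-3 * s) * (Real.exp (13 / 24 * L)) ^ (suppσ σ ∩ S).card),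
    card_theta, Finset.sum_add_distrib, ← Finset.mul_sum]
  have hz : 1 ≤ Real.exp (13 / 24 * L) := Real.one_le_exp (by positivity)
  have hm := hyper_mgf d s (hs.trans hsd) hsd (suppσ σ) hSσ (Real.exp (13 / 24 * L) - 1)
    (by linarith)
  rw [sub_add_cancel] at hm
  have hp : ((Real.exp (13 / 24 * L) - 1) * (s / d) + 1) ^ s ≤ Real.exp (3 * s) := by
    have h1 : (Real.exp (13 / 24 * L) - 1) * (s / d) ≤ 3 := by
      have h2 : Real.exp (13 / 24 * L) ≤ Real.exp L := Real.exp_le_exp.2 (by linarith)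
      calc _ ≤ Real.exp L * (s / d) := by gcongr; linarith
        _ = Real.exp 1 := by rw [hexpL]; field_simp
        _ ≤ 3 := by linarith [Real.exp_one_lt_d9]
    have h0 : 0 ≤ (Real.exp (13 / 24 * L) - 1) * (s / d) := by
      have : 0 ≤ Real.exp (13 / 24 * L) - 1 := by linarith
      positivity
    calc _ ≤ (Real.exp 3) ^ s := by
          gcongr
          exact (Real.add_one_le_exp _).trans (Real.exp_le_exp.2 h1)
      _ = _ := by rw [← Real.exp_nat_mul, mul_comm]
  have : Real.exp (-3 * s) * ∑ S' ∈ Finset.powersetCard s (Finset.univ : Finset (Fin d)),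
      (Real.exp (13 / 24 * L)) ^ (suppσ σ ∩ S').card ≤ Nat.choose d s := by
    calc _ ≤ Real.exp (-3 * s) * (Nat.choose d s * Real.exp (3 * s)) := by
          gcongr; exact hm.trans (by gcongr)
      _ = Nat.choose d s * (Real.exp (-3 * s) * Real.exp (3 * s)) := by ring
      _ = _ := by rw [← Real.exp_add]; simp
  have h2s : (0 : ℝ) < 2 ^ s := by positivity
  simp only [Finset.sum_const, Finset.card_powersetCard, Finset.card_univ, Fintype.card_fin,
    nsmul_eq_mul]
  nlinarith

lemma gaussI_prod {d : ℕ} (μ : Fin d → ℝ) (x : Fin d → ℝ) :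
    gaussI μ x = ∏ i, ((√(2 * π))⁻¹ * Real.exp (-(1 / 2) * (x i - μ i) ^ 2)) := by
  rw [Finset.prod_mul_distrib, ← Real.exp_sum, ← Finset.mul_sum, gaussI]
  congr 1
  rw [Finset.prod_const, Finset.card_univ, Fintype.card_fin, Real.sqrt_eq_rpow,
    ← Real.rpow_neg (by positivity), ← Real.rpow_natCast, ← Real.rpow_mul (by positivity)]
  congr 1
  ring

lemma gaussI_pos {d : ℕ} (μ : Fin d → ℝ) (x : Fin d → ℝ) : 0 < gaussI μ x := by
  unfold gaussI; positivity

lemma gaussI_integrable {d : ℕ} (μ : Fin d → ℝ) : Integrable (gaussI μ) := by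
  have : gaussI μ = fun x : Fin d → ℝ => ∏ i, ((√(2 * π))⁻¹ * Real.exp (-(1 / 2) * (x i - μ i) ^ 2)) := by
    funext x; exact gaussI_prod μ x
  rw [this]
  refine Integrable.fintype_prod
    (f := fun i (y : ℝ) => (√(2 * π))⁻¹ * Real.exp (-(1 / 2) * (y - μ i) ^ 2)) fun i => ?_
  have h := (integrable_exp_neg_mul_sq (b := 1 / 2) (by norm_num)).comp_sub_right (μ i)
  exact h.const_mul _

lemma gaussI_integral {d : ℕ} (μ : Fin d → ℝ) : ∫ x, gaussI μ x = 1 := by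
  simp only [gaussI_prod]
  rw [integral_fintype_prod_volume_eq_prod
    (f := fun i (y : ℝ) => (√(2 * π))⁻¹ * Real.exp (-(1 / 2) * (y - μ i) ^ 2))]
  refine Finset.prod_eq_one fun i _ => ?_
  rw [integral_const_mul, integral_sub_right_eq_self (fun y => Real.exp (-(1 / 2) * y ^ 2)) (μ i),
    integral_gaussian]
  have : π / (1 / 2) = 2 * π := by ring
  rw [this]
  exact inv_mul_cancel₀ (by positivity)

lemma gaussI_mul {d : ℕ} (a b x : Fin d → ℝ) :
    gaussI a x * gaussI b x / gaussI 0 x = Real.exp (∑ i, a i * b i) * gaussI (a + b) x := by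
  rw [div_eq_iff (gaussI_pos 0 x).ne']
  unfold gaussI
  have : ∀ C e1 e2 e3 e4 e5 : ℝ, e1 + e2 = e3 + e4 + e5 →
      C * Real.exp e1 * (C * Real.exp e2) = Real.exp e3 * (C * Real.exp e4) * (C * Real.exp e5) := by
    intro C e1 e2 e3 e4 e5 h
    have := congrArg Real.exp h
    simp only [Real.exp_add] at this
    linear_combination C ^ 2 * this
  apply this
  simp only [Finset.mul_sum, ← Finset.sum_add_distrib]
  refine Finset.sum_congr rfl fun i _ => ?_
  simp only [Pi.add_apply, Pi.zero_apply]
  ring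

lemma two_point (ε u : ℝ) (h0 : 0 < ε) (h1 : ε ≤ 1 / 3) :
    (1 - ε) * Real.exp u + ε * Real.exp (-((1 - ε) / ε) * u) ≤ Real.exp (u ^ 2 / (2 * ε ^ 2)) := by
  set r := (1 - ε) / ε with hr
  have hre : ε * r = 1 - ε := by rw [hr]; field_simp
  have hone : 1 ≤ (1 - ε) * Real.exp (-u) + ε * Real.exp (r * u) := by
    have a := Real.add_one_le_exp (-u)
    have b := Real.add_one_le_exp (r * u)
    have : ε * (r * u) = (1 - ε) * u := by rw [← mul_assoc, hre]
    nlinarith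
  have hpos : 0 ≤ (1 - ε) * Real.exp u + ε * Real.exp (-r * u) := by
    have : 0 ≤ 1 - ε := by linarith
    positivity
  have hprod : ((1 - ε) * Real.exp u + ε * Real.exp (-r * u)) *
      ((1 - ε) * Real.exp (-u) + ε * Real.exp (r * u)) =
      (1 - ε) ^ 2 + ε ^ 2 + 2 * ε * (1 - ε) * Real.cosh (u / ε) := by
    have e1 : Real.exp u * Real.exp (-u) = 1 := by rw [← Real.exp_add]; simp
    have e2 : Real.exp (-r * u) * Real.exp (r * u) = 1 := by rw [← Real.exp_add]; simp
    have e3 : Real.exp u * Real.exp (r * u) = Real.exp (u / ε) := by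
      rw [← Real.exp_add]; congr 1; rw [hr]; field_simp; ring
    have e4 : Real.exp (-r * u) * Real.exp (-u) = Real.exp (-(u / ε)) := by
      rw [← Real.exp_add]; congr 1; rw [hr]; field_simp; ring
    rw [Real.cosh_eq]
    linear_combination (1 - ε) ^ 2 * e1 + ε ^ 2 * e2 + ε * (1 - ε) * e3 + ε * (1 - ε) * e4
  have hc := Real.one_le_cosh (u / ε)
  have hc2 := Real.cosh_le_exp_half_sq (u / ε)
  have e5 : (u / ε) ^ 2 / 2 = u ^ 2 / (2 * ε ^ 2) := by field_simp
  rw [e5] at hc2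
  refine le_trans ?_ hc2
  have : 0 ≤ 1 - ε := by linarith
  calc _ ≤ ((1 - ε) * Real.exp u + ε * Real.exp (-r * u)) *
      ((1 - ε) * Real.exp (-u) + ε * Real.exp (r * u)) := le_mul_of_one_le_right hpos hone
    _ = _ := hprod
    _ ≤ _ := by nlinarith [mul_nonneg (sq_nonneg (1 - ε)) (sub_nonneg.2 hc),
        mul_nonneg (sq_nonneg ε) (sub_nonneg.2 hc)]

lemma four_point (ε t : ℝ) (h0 : 0 < ε) (h1 : ε ≤ 1 / 3) :
    (1 - ε) ^ 2 * Real.exp t + 2 * ε * (1 - ε) * Real.exp (-((1 - ε) / ε) * t)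
      + ε ^ 2 * Real.exp (((1 - ε) / ε) ^ 2 * t) ≤ Real.exp (t ^ 2 / (2 * ε ^ 4)) := by
  have a := two_point ε t h0 h1
  have b := two_point ε (-((1 - ε) / ε) * t) h0 h1
  have e : -((1 - ε) / ε) * (-((1 - ε) / ε) * t) = ((1 - ε) / ε) ^ 2 * t := by ring
  rw [e] at b
  have h1' : 0 ≤ 1 - ε := by linarith
  have a' : t ^ 2 / (2 * ε ^ 2) ≤ t ^ 2 / (2 * ε ^ 4) := by
    apply div_le_div_of_nonneg_left (sq_nonneg t) (by positivity)
    apply mul_le_mul_of_nonneg_left _ (by norm_num)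
    exact pow_le_pow_of_le_one h0.le (by linarith) (by norm_num)
  have b' : (-((1 - ε) / ε) * t) ^ 2 / (2 * ε ^ 2) ≤ t ^ 2 / (2 * ε ^ 4) := by
    have : (-((1 - ε) / ε) * t) ^ 2 / (2 * ε ^ 2) = (1 - ε) ^ 2 * t ^ 2 / (2 * ε ^ 4) := by
      field_simp
    rw [this]
    gcongr
    have : (1 - ε) ^ 2 ≤ 1 := by nlinarith
    nlinarith [sq_nonneg t]
  have a2 := a.trans (Real.exp_le_exp.2 a')
  have b2 := b.trans (Real.exp_le_exp.2 b')
  nlinarith [mul_le_mul_of_nonneg_left a2 h1', mul_le_mul_of_nonneg_left b2 h0.le]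

lemma test_bound {X ι : Type*} [MeasurableSpace X] (μ : Measure X) (Θ : Finset ι)
    (hΘ : Θ.Nonempty) (η : ℝ) (hη : 0 < η)
    (P : X → ℝ) (hP : ∀ x, 0 < P x) (hPi : Integrable P μ) (hP1 : ∫ x, P x ∂μ = 1)
    (Q : ι → X → ℝ) (hQi : ∀ σ, Integrable (Q σ) μ) (hQ1 : ∀ σ, ∫ x, Q σ x ∂μ = 1)
    (hRi : ∀ σ σ', Integrable (fun x => Q σ x * Q σ' x / P x) μ)
    (hR : ∑ σ ∈ Θ, ∑ σ' ∈ Θ, ∫ x, Q σ x * Q σ' x / P x ∂μ ≤ (1 + 4 * η ^ 2) * (Θ.card : ℝ) ^ 2)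
    (T : X → ℝ) (hT : Measurable T) (hT01 : ∀ x, T x = 0 ∨ T x = 1) :
    (∫ x, T x * P x ∂μ) + (1 / (Θ.card : ℝ)) * ∑ σ ∈ Θ, ∫ x, (1 - T x) * Q σ x ∂μ ≥ 1 - 2 * η := by
  set N : ℝ := (Θ.card : ℝ) with hN
  have hN0 : 0 < N := by rw [hN]; exact_mod_cast hΘ.card_pos
  have i1 : Integrable (fun x => T x * P x) μ :=
    hPi.bdd_mul (c := 1) hT.aestronglyMeasurable (Filter.Eventually.of_forall fun x => by
      rcases hT01 x with h | h <;> simp [h])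
  have i2 : ∀ σ, Integrable (fun x => (1 - T x) * Q σ x) μ := fun σ =>
    (hQi σ).bdd_mul (c := 1) (measurable_const.sub hT).aestronglyMeasurable
      (Filter.Eventually.of_forall fun x => by
      rcases hT01 x with h | h <;> simp [h])
  have i3 : Integrable (fun x => (1 / N) * ∑ σ ∈ Θ, (1 - T x) * Q σ x) μ :=
    (integrable_finsetSum _ fun σ _ => i2 σ).const_mul _
  have i4 : Integrable (fun x => (1 / N) * ∑ σ ∈ Θ, Q σ x) μ :=
    (integrable_finsetSum _ fun σ _ => hQi σ).const_mul _
  have i5 : Integrable (fun x => (1 / N ^ 2) * ∑ σ ∈ Θ, ∑ σ' ∈ Θ, Q σ x * Q σ' x / P x) μ :=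
    (integrable_finsetSum _ fun σ _ => integrable_finsetSum _ fun σ' _ => hRi σ σ').const_mul _
  have eL : (∫ x, T x * P x ∂μ) + (1 / N) * ∑ σ ∈ Θ, ∫ x, (1 - T x) * Q σ x ∂μ =
      ∫ x, (T x * P x + (1 / N) * ∑ σ ∈ Θ, (1 - T x) * Q σ x) ∂μ := by
    rw [integral_add i1 i3, integral_const_mul, integral_finsetSum _ fun σ _ => i2 σ]
  have i6 : Integrable (fun x => (1 - η - 1 / (4 * η)) * P x +
      (1 / (2 * η)) * ((1 / N) * ∑ σ ∈ Θ, Q σ x)) μ :=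
    (hPi.const_mul _).add (i4.const_mul _)
  have i7 := i5.const_mul (1 / (4 * η))
  have eR : ∫ x, (((1 - η - 1 / (4 * η)) * P x +
      (1 / (2 * η)) * ((1 / N) * ∑ σ ∈ Θ, Q σ x)) -
      (1 / (4 * η)) * ((1 / N ^ 2) * ∑ σ ∈ Θ, ∑ σ' ∈ Θ, Q σ x * Q σ' x / P x)) ∂μ =
      (1 - η - 1 / (4 * η)) + 1 / (2 * η) - (1 / (4 * η)) *
        ((1 / N ^ 2) * ∑ σ ∈ Θ, ∑ σ' ∈ Θ, ∫ x, Q σ x * Q σ' x / P x ∂μ) := by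
    rw [integral_sub i6 i7, integral_add (hPi.const_mul _) (i4.const_mul _)]
    simp only [integral_const_mul]
    rw [hP1, integral_finsetSum _ fun σ _ => hQi σ,
      integral_finsetSum _ fun σ _ => integrable_finsetSum _ fun σ' _ => hRi σ σ']
    have : ∀ σ ∈ Θ, ∫ x, ∑ σ' ∈ Θ, Q σ x * Q σ' x / P x ∂μ =
        ∑ σ' ∈ Θ, ∫ x, Q σ x * Q σ' x / P x ∂μ := fun σ _ =>
      integral_finsetSum _ fun σ' _ => hRi σ σ'
    rw [Finset.sum_congr rfl this]
    simp only [hQ1, Finset.sum_const, nsmul_eq_mul, mul_one]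
    rw [← hN, one_div_mul_cancel hN0.ne', mul_one]
  rw [eL, ge_iff_le]
  refine le_trans ?_ (integral_mono (i6.sub i7) (i1.add i3) ?_)
  · refine le_trans ?_ eR.ge
    have : (1 / N ^ 2) * ∑ σ ∈ Θ, ∑ σ' ∈ Θ, ∫ x, Q σ x * Q σ' x / P x ∂μ ≤ 1 + 4 * η ^ 2 := by
      rw [one_div, inv_mul_le_iff₀ (by positivity), mul_comm]; exact hR
    have h2 := mul_le_mul_of_nonneg_left this (by positivity : (0 : ℝ) ≤ 1 / (4 * η))
    have h3 : 1 / (4 * η) * (1 + 4 * η ^ 2) = 1 / (4 * η) + η := by field_simp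
    have h4 : 1 / (2 * η) = 2 * (1 / (4 * η)) := by field_simp; norm_num
    linarith
  · intro x
    simp only [Pi.sub_apply, Pi.add_apply]
    have hp := hP x
    have e1 : ∑ σ ∈ Θ, ∑ σ' ∈ Θ, Q σ x * Q σ' x / P x = (∑ σ ∈ Θ, Q σ x) ^ 2 / P x := by
      rw [sq, Finset.sum_mul_sum, Finset.sum_div]
      exact Finset.sum_congr rfl fun σ _ => by rw [Finset.sum_div]
    have e2 : (1 / N ^ 2) * ∑ σ ∈ Θ, ∑ σ' ∈ Θ, Q σ x * Q σ' x / P x =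
        ((1 / N) * ∑ σ ∈ Θ, Q σ x) ^ 2 / P x := by
      rw [e1]; field_simp
    rw [e2, ← Finset.mul_sum]
    have e3 : (1 / N) * ((1 - T x) * ∑ σ ∈ Θ, Q σ x) = (1 - T x) * ((1 / N) * ∑ σ ∈ Θ, Q σ x) := by
      ring
    rw [e3]
    set D := (1 / N) * ∑ σ ∈ Θ, Q σ x
    set p := P x
    have k1 : (1 - η - 1 / (4 * η)) * p + 1 / (2 * η) * D - 1 / (4 * η) * (D ^ 2 / p) =
        p - (η * p + (p - D) ^ 2 / (4 * η * p)) := by field_simp; ring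
    have k2 : |p - D| ≤ η * p + (p - D) ^ 2 / (4 * η * p) := by
      have : η * p + (p - D) ^ 2 / (4 * η * p) - |p - D| = (2 * η * p - |p - D|) ^ 2 / (4 * η * p) := by
        rw [← sq_abs (p - D)]
        field_simp; ring
      have h5 : 0 ≤ (2 * η * p - |p - D|) ^ 2 / (4 * η * p) := by positivity
      linarith
    rw [k1]
    rcases hT01 x with h | h <;> rw [h]
    · have := le_abs_self (p - D); linarith
    · have := abs_nonneg (p - D); linarith

lemma q_chi {d : ℕ} (ε γ : ℝ) (h0 : 0 < ε) (h1 : ε ≤ 1 / 3) (a b : Fin d → ℝ)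
    (qa qb : (Fin d → ℝ) → ℝ)
    (ha : ∀ x, qa x = (1 - ε) * gaussI (γ • a) x + ε * gaussI ((-((1 - ε) / ε) * γ) • a) x)
    (hb : ∀ x, qb x = (1 - ε) * gaussI (γ • b) x + ε * gaussI ((-((1 - ε) / ε) * γ) • b) x) :
    Integrable (fun x => qa x * qb x / gaussI 0 x) ∧
    0 ≤ ∫ x, qa x * qb x / gaussI 0 x ∧
    ∫ x, qa x * qb x / gaussI 0 x ≤ Real.exp ((γ ^ 2 * ∑ i, a i * b i) ^ 2 / (2 * ε ^ 4)) := by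
  set r := (1 - ε) / ε with hr
  have hε1 : 0 ≤ 1 - ε := by linarith
  have hpt : (fun x => qa x * qb x / gaussI 0 x) = fun x =>
      ((1 - ε) ^ 2 * Real.exp (γ ^ 2 * ∑ i, a i * b i)) * gaussI (γ • a + γ • b) x +
      (ε * (1 - ε) * Real.exp (-r * (γ ^ 2 * ∑ i, a i * b i))) * gaussI (γ • a + (-r * γ) • b) x +
      ((ε * (1 - ε) * Real.exp (-r * (γ ^ 2 * ∑ i, a i * b i))) * gaussI ((-r * γ) • a + γ • b) x +
      (ε ^ 2 * Real.exp (r ^ 2 * (γ ^ 2 * ∑ i, a i * b i))) *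
        gaussI ((-r * γ) • a + (-r * γ) • b) x) := by
    funext x
    rw [ha, hb]
    have e : ∀ u v : ℝ, ∑ i, (u • a) i * (v • b) i = u * v * ∑ i, a i * b i := by
      intro u v
      rw [Finset.mul_sum]
      refine Finset.sum_congr rfl fun i _ => ?_
      simp only [Pi.smul_apply, smul_eq_mul]; ring
    have m1 := gaussI_mul (γ • a) (γ • b) x
    have m2 := gaussI_mul (γ • a) ((-r * γ) • b) x
    have m3 := gaussI_mul ((-r * γ) • a) (γ • b) x
    have m4 := gaussI_mul ((-r * γ) • a) ((-r * γ) • b) x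
    rw [e] at m1 m2 m3 m4
    have f1 : γ * γ * ∑ i, a i * b i = γ ^ 2 * ∑ i, a i * b i := by ring
    have f2 : γ * (-r * γ) * ∑ i, a i * b i = -r * (γ ^ 2 * ∑ i, a i * b i) := by ring
    have f3 : -r * γ * γ * ∑ i, a i * b i = -r * (γ ^ 2 * ∑ i, a i * b i) := by ring
    have f4 : -r * γ * (-r * γ) * ∑ i, a i * b i = r ^ 2 * (γ ^ 2 * ∑ i, a i * b i) := by ring
    rw [f1] at m1
    rw [f2] at m2
    rw [f3] at m3
    rw [f4] at m4
    linear_combination (1 - ε) ^ 2 * m1 + ε * (1 - ε) * m2 + ε * (1 - ε) * m3 + ε ^ 2 * m4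
  have i1 := fun (c : ℝ) (m : Fin d → ℝ) => (gaussI_integrable m).const_mul c
  have i2 : ∀ (c c' : ℝ) (m m' : Fin d → ℝ),
      Integrable (fun x => c * gaussI m x + c' * gaussI m' x) :=
    fun c c' m m' => (i1 c m).add (i1 c' m')
  rw [hpt]
  refine ⟨((i1 _ _).add (i1 _ _)).add ((i1 _ _).add (i1 _ _)), ?_, ?_⟩
  · apply integral_nonneg
    intro x
    have := gaussI_pos (γ • a + γ • b) x
    have := gaussI_pos (γ • a + (-r * γ) • b) x
    have := gaussI_pos ((-r * γ) • a + γ • b) x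
    have := gaussI_pos ((-r * γ) • a + (-r * γ) • b) x
    simp only [Pi.zero_apply]
    positivity
  · rw [integral_add (i2 _ _ _ _) (i2 _ _ _ _),
      integral_add (i1 _ _) (i1 _ _), integral_add (i1 _ _) (i1 _ _)]
    simp only [integral_const_mul, gaussI_integral]
    have := four_point ε (γ ^ 2 * ∑ i, a i * b i) h0 h1
    rw [← hr] at this
    linarith

set_option maxHeartbeats 400000

/-- robust `s`-sparse Gaussian mean testing is impossible with
`n ≤ c (ε⁴/γ⁴) s log(ed/s)` samples: every `{0,1}`-valued test `T` has total error
probability at least `1 − 2η`. Vectors of `Θ`, with entries in `{−1/√s, 0, 1/√s}` and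
exactly `s` nonzero coordinates, are encoded by `σ : Fin d → Fin 3` via
`θ σ i = ((σ i : ℝ) − 1)/√s`. -/
theorem stmt8 (η : ℝ) (hη : η ∈ Set.Ioo (0 : ℝ) 1) :
    ∃ c : ℝ, 0 < c ∧
      ∀ (ε : ℝ), ε ∈ Set.Ioc 0 (1 / 3 : ℝ) → ∀ γ : ℝ, 0 < γ →
      ∀ (d s n : ℕ), 1 ≤ d → 1 ≤ s → s ≤ d → 1 ≤ n →
        (n : ℝ) ≤ c * (ε ^ 4 / γ ^ 4) * s * Real.log (Real.exp 1 * d / s) →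
      ∀ Θ : Finset (Fin d → Fin 3),
        Θ = Finset.univ.filter
          (fun σ => (Finset.univ.filter (fun i => σ i ≠ 1)).card = s) →
      ∀ θ : (Fin d → Fin 3) → Fin d → ℝ,
        (∀ σ i, θ σ i = (((σ i : ℕ) : ℝ) - 1) / Real.sqrt s) →
      ∀ q : (Fin d → Fin 3) → (Fin d → ℝ) → ℝ,
        (∀ σ x, q σ x =
          (1 - ε) * gaussI (γ • θ σ) x + ε * gaussI ((-((1 - ε) / ε) * γ) • θ σ) x) →
      ∀ T : (Fin n → Fin d → ℝ) → ℝ, Measurable T → (∀ x, T x = 0 ∨ T x = 1) →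
        (∫ x : Fin n → Fin d → ℝ, T x * ∏ i, gaussI 0 (x i)) +
            (1 / (Θ.card : ℝ)) *
              ∑ σ ∈ Θ, ∫ x : Fin n → Fin d → ℝ, (1 - T x) * ∏ i, q σ (x i)
          ≥ 1 - 2 * η := by
  obtain ⟨hη0, hη1⟩ := hη
  refine ⟨η ^ 2 / 12, by positivity, ?_⟩
  rintro ε ⟨h0, h1⟩ γ hγ d s n hd hs hsd hn hnle Θ hΘ θ hθ q hq T hT hT01
  have hΘ' : Θ = thetaSet d s := by rw [hΘ]; rfl
  have hs' : (0 : ℝ) < s := by exact_mod_cast hs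
  have hcard : 0 < (Θ.card : ℝ) := by
    rw [hΘ', card_theta]
    have : 0 < d.choose s := Nat.choose_pos hsd
    positivity
  have hqi : ∀ σ, Integrable (q σ) := by
    intro σ
    rw [funext (hq σ)]
    exact ((gaussI_integrable _).const_mul _).add ((gaussI_integrable _).const_mul _)
  have hq1 : ∀ σ, ∫ x, q σ x = 1 := by
    intro σ
    rw [funext (hq σ), integral_add ((gaussI_integrable _).const_mul _)
      ((gaussI_integrable _).const_mul _)]
    simp only [integral_const_mul, gaussI_integral]
    ring
  have hchi := fun σ σ' => q_chi ε γ h0 h1 (θ σ) (θ σ') (q σ) (q σ') (hq σ) (hq σ')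
  have hprod : ∀ σ σ', (fun x : Fin n → Fin d → ℝ =>
      (∏ i, q σ (x i)) * (∏ i, q σ' (x i)) / ∏ i, gaussI 0 (x i)) =
      fun x => ∏ i, (q σ (x i) * q σ' (x i) / gaussI 0 (x i)) := by
    intro σ σ'
    funext x
    rw [Finset.prod_div_distrib, Finset.prod_mul_distrib]
  set L := Real.log (Real.exp 1 * d / s) with hL
  have hint : ∀ σ σ', ∫ x : Fin n → Fin d → ℝ,
      (∏ i, q σ (x i)) * (∏ i, q σ' (x i)) / ∏ i, gaussI 0 (x i) ≤
      1 - η ^ 2 + η ^ 2 * Real.exp (L / 24 * ((∑ i, vv (σ i) * vv (σ' i)) ^ 2 / s)) := by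
    intro σ σ'
    rw [hprod, integral_fintype_prod_volume_eq_pow (fun y => q σ y * q σ' y / gaussI 0 y),
      Fintype.card_fin]
    obtain ⟨_, hnn, hle⟩ := hchi σ σ'
    set k := ∑ i, vv (σ i) * vv (σ' i) with hk
    have hθk : ∑ i, θ σ i * θ σ' i = k / s := by
      rw [hk, Finset.sum_div]
      refine Finset.sum_congr rfl fun i _ => ?_
      rw [hθ, hθ, div_mul_div_comm, Real.mul_self_sqrt hs'.le]; rfl
    rw [hθk] at hle
    have hY : (n : ℝ) * ((γ ^ 2 * (k / s)) ^ 2 / (2 * ε ^ 4)) ≤ η ^ 2 * (L / 24 * (k ^ 2 / s)) := by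
      calc (n : ℝ) * ((γ ^ 2 * (k / s)) ^ 2 / (2 * ε ^ 4)) ≤
          (η ^ 2 / 12 * (ε ^ 4 / γ ^ 4) * s * L) * ((γ ^ 2 * (k / s)) ^ 2 / (2 * ε ^ 4)) := by
            gcongr
        _ = _ := by field_simp; ring
    calc _ ≤ (Real.exp ((γ ^ 2 * (k / s)) ^ 2 / (2 * ε ^ 4))) ^ n := by gcongr
      _ = Real.exp (n * ((γ ^ 2 * (k / s)) ^ 2 / (2 * ε ^ 4))) := by rw [← Real.exp_nat_mul]
      _ ≤ Real.exp (η ^ 2 * (L / 24 * (k ^ 2 / s))) := Real.exp_le_exp.2 hY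
      _ ≤ _ := by
        have hc := convexOn_exp.2 (Set.mem_univ (0 : ℝ)) (Set.mem_univ (L / 24 * (k ^ 2 / s)))
          (by nlinarith : 0 ≤ 1 - η ^ 2) (by positivity : 0 ≤ η ^ 2) (by ring)
        simpa using hc
  have hne : Θ.Nonempty := Finset.card_pos.1 (by exact_mod_cast hcard)
  have g1 : Integrable (fun x : Fin n → Fin d → ℝ => ∏ i, gaussI 0 (x i)) :=
    Integrable.fintype_prod (f := fun _ : Fin n => gaussI (0 : Fin d → ℝ))
      fun _ => gaussI_integrable _
  have g2 : ∫ x : Fin n → Fin d → ℝ, ∏ i, gaussI 0 (x i) = 1 := by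
    rw [integral_fintype_prod_volume_eq_pow (gaussI 0), gaussI_integral, one_pow]
  have g3 : ∀ σ, Integrable (fun x : Fin n → Fin d → ℝ => ∏ i, q σ (x i)) := fun σ =>
    Integrable.fintype_prod (f := fun _ : Fin n => q σ) fun _ => hqi σ
  have g4 : ∀ σ, ∫ x : Fin n → Fin d → ℝ, ∏ i, q σ (x i) = 1 := by
    intro σ
    rw [integral_fintype_prod_volume_eq_pow (q σ), hq1, one_pow]
  have g5 : ∀ σ σ', Integrable (fun x : Fin n → Fin d → ℝ =>
      (∏ i, q σ (x i)) * (∏ i, q σ' (x i)) / ∏ i, gaussI 0 (x i)) := by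
    intro σ σ'
    rw [hprod]
    exact Integrable.fintype_prod (f := fun _ : Fin n => fun y => q σ y * q σ' y / gaussI 0 y)
      fun _ => (hchi σ σ').1
  have hrow : ∀ σ ∈ Θ, ∑ σ' ∈ Θ, ∫ x : Fin n → Fin d → ℝ,
      (∏ i, q σ (x i)) * (∏ i, q σ' (x i)) / ∏ i, gaussI 0 (x i) ≤ (1 + 4 * η ^ 2) * Θ.card := by
    intro σ hσ
    refine (Finset.sum_le_sum fun σ' _ => hint σ σ').trans ?_
    rw [Finset.sum_add_distrib, ← Finset.mul_sum, Finset.sum_const, nsmul_eq_mul]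
    have := theta_avg d s hs hsd σ (hΘ' ▸ hσ)
    rw [← hΘ', ← hL] at this
    nlinarith [mul_le_mul_of_nonneg_left this (sq_nonneg η), mul_nonneg (sq_nonneg η) hcard.le]
  have g6 : ∑ σ ∈ Θ, ∑ σ' ∈ Θ, ∫ x : Fin n → Fin d → ℝ,
      (∏ i, q σ (x i)) * (∏ i, q σ' (x i)) / ∏ i, gaussI 0 (x i) ≤
      (1 + 4 * η ^ 2) * (Θ.card : ℝ) ^ 2 := by
    refine (Finset.sum_le_card_nsmul _ _ _ hrow).trans ?_
    rw [nsmul_eq_mul]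
    exact le_of_eq (by ring)
  have hpos : ∀ x : Fin n → Fin d → ℝ, 0 < ∏ i, gaussI 0 (x i) :=
    fun x => Finset.prod_pos fun i _ => gaussI_pos _ _
  clear hΘ hint hrow hchi
  have key := test_bound (X := Fin n → Fin d → ℝ) volume Θ hne η hη0
    (fun x : Fin n → Fin d → ℝ => ∏ i, gaussI 0 (x i)) hpos g1 g2
    (fun (σ : Fin d → Fin 3) (x : Fin n → Fin d → ℝ) => ∏ i, q σ (x i)) g3 g4 g5 g6 T hT hT01
  exact key
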